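/- arXiv:math-ph/0208027 — 2 statements merged into one kernel-verified Lean document; each statement's English description precedes it below -/
import Mathlib

section
/- Let d ≥ 1 and r > 0. Let ω ⊆ ℝ^d be uniformly discrete with radius r (i.e. ‖x − y‖ ≥ 2r for distinct x, y ∈ ω), let S ⊆ ω, and let V ⊆ B(0, r/42) ∖ {0} be a finite set such that for every v ∈ V there exists w ∈ V ∪ {0} with ‖v − w‖ > r/42. Define ω^b = ω ∪ ⋃_{t ∈ S} (t + V). Then {x ∈ ω^b : ω^b ∩ B(x, r/3) = ω^b ∩ B(x, r/42)} = ω. In other words, the local derivation map D sending ω to ω^b is inverted by the local rule H(ω^b) = {x ∈ ω^b : ω^b ∩ B(x, r/3) = ω^b ∩ B(x, r/42)}. -/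
open Metric

/-- Let `d ≥ 1`, `r > 0`, `ω ⊆ ℝ^d` uniformly discrete with
radius `r`, `S ⊆ ω`, and `V ⊆ B(0, r/42) \ {0}` a finite set such that every
`v ∈ V` has some `w ∈ V ∪ {0}` with `‖v − w‖ > r/42`. With
`ω^b = ω ∪ ⋃_{t ∈ S} (t + V)`, the local rule
`H(ω^b) = {x ∈ ω^b : ω^b ∩ B(x, r/3) = ω^b ∩ B(x, r/42)}` recovers `ω`. -/
theorem local_derivation_inverse
    (d : ℕ) (hd : 1 ≤ d) (r : ℝ) (hr : 0 < r)
    (ω : Set (EuclideanSpace ℝ (Fin d)))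
    (hdisc : ∀ x ∈ ω, ∀ y ∈ ω, x ≠ y → 2 * r ≤ ‖x - y‖)
    (S : Set (EuclideanSpace ℝ (Fin d))) (hS : S ⊆ ω)
    (V : Set (EuclideanSpace ℝ (Fin d))) (hVfin : V.Finite)
    (hV : V ⊆ closedBall 0 (r / 42) \ {0})
    (hVsep : ∀ v ∈ V, ∃ w ∈ V ∪ {(0 : EuclideanSpace ℝ (Fin d))}, r / 42 < ‖v - w‖)
    (ωb : Set (EuclideanSpace ℝ (Fin d)))
    (hωb : ωb = ω ∪ ⋃ t ∈ S, (fun v => t + v) '' V) :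
    {x ∈ ωb | ωb ∩ closedBall x (r / 3) = ωb ∩ closedBall x (r / 42)} = ω := by
  have hmem : ∀ y, y ∈ ωb ↔ y ∈ ω ∨ ∃ t ∈ S, ∃ v ∈ V, t + v = y := by
    intro y
    simp only [hωb, Set.mem_union, Set.mem_iUnion, Set.mem_image, exists_prop]
  have hVnorm : ∀ v ∈ V, ‖v‖ ≤ r / 42 := fun v hv => by simpa using (hV hv).1
  ext x
  constructor
  · rintro ⟨hx, heq⟩
    rcases (hmem x).1 hx with hx | ⟨t, ht, v, hv, rfl⟩
    · exact hx
    · exfalso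
      obtain ⟨w, hw, hvw⟩ := hVsep v hv
      have hwnorm : ‖w‖ ≤ r / 42 := by
        rcases hw with hw | rfl
        · exact hVnorm w hw
        · rw [norm_zero]
          positivity
      have htw : t + w ∈ ωb := by
        rw [hmem]
        rcases hw with hw | rfl
        · exact Or.inr ⟨t, ht, w, hw, rfl⟩
        · exact Or.inl (by simpa using hS ht)
      have hdist : dist (t + w) (t + v) = ‖v - w‖ := by
        rw [dist_add_left, dist_eq_norm, norm_sub_rev]
      have hle : ‖v - w‖ ≤ r / 3 := by
        linarith [norm_sub_le v w, hVnorm v hv]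
      have hin : t + w ∈ ωb ∩ closedBall (t + v) (r / 42) :=
        heq ▸ ⟨htw, by rw [mem_closedBall, hdist]; exact hle⟩
      have hclose := mem_closedBall.1 hin.2
      rw [hdist] at hclose
      linarith
  · intro hx
    refine ⟨(hmem x).2 (Or.inl hx), Set.Subset.antisymm ?_ ?_⟩
    · rintro y ⟨hy, hyx⟩
      refine ⟨hy, ?_⟩
      rw [mem_closedBall, dist_eq_norm] at hyx ⊢
      rcases (hmem y).1 hy with hyω | ⟨t, ht, v, hv, rfl⟩
      · have hyx' : y = x := by
          by_contra hne
          linarith [hdisc y hyω x hx hne]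
        rw [hyx', sub_self, norm_zero]
        positivity
      · have htx : t = x := by
          by_contra hne
          have htri := norm_sub_le (t + v - x) v
          rw [show t + v - x - v = t - x by abel] at htri
          linarith [hdisc t (hS ht) x hx hne, hVnorm v hv]
        rw [htx, add_sub_cancel_left]
        exact hVnorm v hv
    · exact Set.inter_subset_inter_right _ (closedBall_subset_closedBall (by linarith))
end

section
/- Let d ≥ 1, let ω ⊆ ℝ^d be locally finite, and let A : ω × ω → ℂ satisfy A(x, y) = 0 whenever ‖x − y‖ ≥ r_A, for a fixed r_A > 0. Let p ∈ ℝ^d, r > 0, E ∈ ℂ, and let u : ω → ℂ be supported in ω ∩ B(p, r) and satisfy Σ_{y ∈ ω} A(x, y) u(y) = E·u(x) for all x ∈ ω. Let t ∈ ℝ^d be such that ω ∩ B(p + t, r + 2r_A) = (ω ∩ B(p, r + 2r_A)) + t and A(x + t, y + t) = A(x, y) for all x, y ∈ ω ∩ B(p, r + 2r_A). Define u_t : ω → ℂ by u_t(x) = u(x − t) if x − t ∈ ω ∩ B(p, r) and u_t(x) = 0 otherwise. Then u_t is supported in ω ∩ B(p + t, r) and Σ_{y ∈ ω} A(x, y)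 u_t(y) = E·u_t(x) for all x ∈ ω; that is, every translated copy of the local pattern on which A is equivariant carries a translated copy of the locally supported eigenfunction. -/
open Metric

/-- Let `ω ⊆ ℝ^d` be locally finite and `A` a kernel on `ω` of
finite range `r_A`. Suppose `u` is an eigenfunction of `A` with eigenvalue `E`
supported in `ω ∩ B(p, r)`, and `t ∈ ℝ^d` is such that
`ω ∩ B(p + t, r + 2r_A) = (ω ∩ B(p, r + 2r_A)) + t` and `A` is equivariant under
translation by `t` on `ω ∩ B(p, r + 2r_A)`. Then the translated function
`u_t(x) = u(x − t)` if `x − t ∈ ω ∩ B(p, r)` and `0` otherwise (i.e.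
`u_t = indicator (ω ∩ B(p, r)) u ∘ (· − t)`) is supported in `ω ∩ B(p + t, r)`
and is again an eigenfunction of `A` with eigenvalue `E`. -/
theorem translated_local_eigenfunction
    (d : ℕ) (hd : 1 ≤ d)
    (ω : Set (EuclideanSpace ℝ (Fin d)))
    (hloc : ∀ B : Set (EuclideanSpace ℝ (Fin d)),
      Bornology.IsBounded B → (ω ∩ B).Finite)
    (A : EuclideanSpace ℝ (Fin d) → EuclideanSpace ℝ (Fin d) → ℂ)
    (r_A : ℝ) (hrA : 0 < r_A)
    (hA : ∀ x ∈ ω, ∀ y ∈ ω, r_A ≤ ‖x - y‖ → A x y = 0)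
    (p t : EuclideanSpace ℝ (Fin d)) (r : ℝ) (hr : 0 < r) (E : ℂ)
    (u : EuclideanSpace ℝ (Fin d) → ℂ)
    (hu : ∀ x, x ∉ ω ∩ closedBall p r → u x = 0)
    (heig : ∀ x ∈ ω, ∑ᶠ y ∈ ω, A x y * u y = E * u x)
    (ht₁ : (fun x => x + t) '' (ω ∩ closedBall p (r + 2 * r_A))
      = ω ∩ closedBall (p + t) (r + 2 * r_A))
    (ht₂ : ∀ x ∈ ω ∩ closedBall p (r + 2 * r_A),
      ∀ y ∈ ω ∩ closedBall p (r + 2 * r_A), A (x + t) (y + t) = A x y)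
    (ut : EuclideanSpace ℝ (Fin d) → ℂ)
    (hut : ∀ x, ut x = Set.indicator (ω ∩ closedBall p r) u (x - t)) :
    (∀ x, x ∉ ω ∩ closedBall (p + t) r → ut x = 0) ∧
      (∀ x ∈ ω, ∑ᶠ y ∈ ω, A x y * ut y = E * ut x) := by
  have hut' : ∀ x, ut x = u (x - t) := fun x => by
    rw [hut, Set.indicator_eq_self.2]
    exact fun y hy => by_contra fun h => hy (hu y h)
  have hshift : ∀ z ∈ ω ∩ closedBall p (r + 2 * r_A),
      z + t ∈ ω ∩ closedBall (p + t) (r + 2 * r_A) := fun z hz =>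
    ht₁ ▸ Set.mem_image_of_mem _ hz
  have hlarge : ∀ z ∈ ω ∩ closedBall p r, z ∈ ω ∩ closedBall p (r + 2 * r_A) := fun z hz =>
    ⟨hz.1, closedBall_subset_closedBall (by linarith) hz.2⟩
  have hsupp : ∀ x, x ∉ ω ∩ closedBall (p + t) r → ut x = 0 := by
    intro x hx
    rw [hut']
    refine hu _ fun h => hx ⟨?_, ?_⟩
    · simpa using (hshift _ (hlarge _ h)).1
    · have h2 := h.2
      rw [mem_closedBall, dist_eq_norm] at h2 ⊢
      rwa [← sub_sub_sub_cancel_right x (p + t) t, add_sub_cancel_right]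
  refine ⟨hsupp, fun x hx => ?_⟩
  by_cases hxB : x ∈ closedBall (p + t) (r + 2 * r_A)
  · obtain ⟨w, hw, rfl⟩ : x ∈ (fun x => x + t) '' (ω ∩ closedBall p (r + 2 * r_A)) :=
      ht₁ ▸ ⟨hx, hxB⟩
    simp only [hut', add_sub_cancel_right]
    rw [← heig w hw.1, ← finsum_comp_equiv (Equiv.addRight t)]
    refine finsum_congr fun z => ?_
    simp only [Equiv.coe_addRight, add_sub_cancel_right]
    by_cases hz : z ∈ ω ∩ closedBall p r
    · have hzt := hlarge z hz
      simp [hz.1, (hshift z hzt).1, ht₂ w hw z hzt]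
    · simp [hu z hz]
  · have hfar : ∀ y, y ∈ ω → A x y * ut y = 0 := by
      intro y hy
      by_cases hyB : y ∈ closedBall (p + t) r
      · rw [hA x hx y hy, zero_mul]
        rw [mem_closedBall] at hxB hyB
        rw [← dist_eq_norm]
        linarith [dist_triangle x y (p + t)]
      · rw [hsupp y fun h => hyB h.2, mul_zero]
    rw [hsupp x fun h => hxB (closedBall_subset_closedBall (by linarith) h.2), mul_zero]
    exact finsum_mem_eq_zero_of_forall_eq_zero hfar
end
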